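/- If F is a linear combination of Schur polynomials such that any two Schur polynomials of the same degree appearing in F have coefficients of the same sign, and there exist partitions lambda_bar ≤ lambda_hat such that s_mu appears in F if and only if lambda_bar ≤ mu ≤ lambda_hat (componentwise), then F has saturated Newton polytope and Newton(F) has the integer decomposition property. -/

import Mathlib

open Finset Pointwise

/-- The Young diagram of a partition with at most `m` parts given as an antitone map. -/
def diagramOf {m : ℕ} (lam : Fin m → ℕ) (h : Antitone lam) : YoungDiagram where
  cells := Finset.univ.biUnion fun i : Fin m =>
    (Finset.range (lam i)).image fun j => ((i : ℕ), j)
  isLowerSet := by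
    rintro ⟨i₁, j₁⟩ ⟨i₂, j₂⟩ ⟨hi, hj⟩ hm
    simp only [Finset.coe_biUnion, Finset.coe_univ, Set.mem_iUnion, Finset.mem_coe,
      Finset.mem_image, Finset.mem_range, Set.mem_univ, true_and, Set.iUnion_true] at hm ⊢
    obtain ⟨i, j, hj', hij⟩ := hm
    have hi1 : (i₁ : ℕ) = (i : ℕ) := ((Prod.mk.injEq _ _ _ _).mp hij).1.symm
    have hj1 : j₁ = j := ((Prod.mk.injEq _ _ _ _).mp hij).2.symm
    have hi2m : i₂ < m := lt_of_le_of_lt (le_of_le_of_eq hi hi1) i.isLt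
    refine ⟨⟨i₂, hi2m⟩, j₂, ?_, rfl⟩
    have : lam i ≤ lam ⟨i₂, hi2m⟩ := h (by simpa [Fin.le_def] using le_of_le_of_eq hi hi1)
    omega

/-- The content of a tableau: the number of cells with entry `e`. -/
def content (μ : YoungDiagram) (T : SemistandardYoungTableau μ) (e : ℕ) : ℕ :=
  (μ.cells.filter fun c => T c.1 c.2 = e).card

/-- The coefficient of `x^α` in the Schur polynomial `s_μ(x_1, …, x_m)`: the number of
semistandard Young tableaux of shape `μ` with entries in `{0, …, m-1}` and content `α`. -/
noncomputable def schurCoeff (m : ℕ) (μ : YoungDiagram) (α : Fin m → ℕ) : ℕ :=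
  Nat.card {T : SemistandardYoungTableau μ // (∀ i j : ℕ, (i, j) ∈ μ → T i j < m) ∧
    ∀ k : Fin m, content μ T (k : ℕ) = α k}

/-- The Schur polynomial, viewed as its coefficient function. -/
noncomputable def schurR (m : ℕ) (μ : YoungDiagram) : (Fin m → ℕ) → ℝ :=
  fun α => (schurCoeff m μ α : ℝ)

/-- The support of a polynomial (given by its coefficient function), as a set of points of `ℝ^m`. -/
def Supp {m : ℕ} (F : (Fin m → ℕ) → ℝ) : Set (Fin m → ℝ) :=
  {x | ∃ α : Fin m → ℕ, F α ≠ 0 ∧ x = fun i => (α i : ℝ)}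

/-- The Newton polytope of a polynomial. -/
def NewtonP {m : ℕ} (F : (Fin m → ℕ) → ℝ) : Set (Fin m → ℝ) :=
  convexHull ℝ (Supp F)

/-- A lattice point of `ℝ^m`. -/
def IsLattice {m : ℕ} (x : Fin m → ℝ) : Prop := ∀ i, ∃ z : ℤ, x i = z

/-- Saturated Newton polytope. -/
def HasSNP {m : ℕ} (F : (Fin m → ℕ) → ℝ) : Prop :=
  NewtonP F ∩ {x | IsLattice x} = Supp F

/-- Integer decomposition property of a subset of `ℝ^m`. -/
def HasIDP {m : ℕ} (P : Set (Fin m → ℝ)) : Prop :=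
  ∀ t : ℕ, 0 < t → ∀ p ∈ (t : ℝ) • P, IsLattice p →
    ∃ v : Fin t → (Fin m → ℝ), (∀ j, v j ∈ P ∧ IsLattice (v j)) ∧ p = ∑ j, v j

/-- `b` dominates `a`: every partial sum of `b` is at least that of `a`. -/
def Dominates {m : ℕ} (a b : Fin m → ℕ) : Prop :=
  ∀ j : Fin m, ∑ i ∈ Finset.univ.filter (· ≤ j), a i ≤ ∑ i ∈ Finset.univ.filter (· ≤ j), b i

/-- The `S_m`-orbit of a point of `ℕ^m`, as a subset of `ℝ^m`. -/
def orbitR {m : ℕ} (lam : Fin m → ℕ) : Set (Fin m → ℝ) :=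
  {x | ∃ σ : Equiv.Perm (Fin m), x = fun i => (lam (σ i) : ℝ)}

/-- Add a box to row `r`. -/
def AddBoxAt {m : ℕ} (ν : Fin m → ℕ) (r : Fin m) : Fin m → ℕ :=
  Function.update ν r (ν r + 1)

/-- `ν'` is obtained from `ν` by adding a box in the northmost row such that the result is
a partition that is at most `β`. -/
def NorthmostStep {m : ℕ} (β ν ν' : Fin m → ℕ) : Prop :=
  ∃ r : Fin m, ν' = AddBoxAt ν r ∧ Antitone ν' ∧ ν' ≤ β ∧
    ∀ r' : Fin m, r' < r → ¬ (Antitone (AddBoxAt ν r') ∧ AddBoxAt ν r' ≤ β)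

theorem aux_thr (p : ℕ → ℕ) (hp : Antitone p) (s m : ℕ) :
    ∃ k ≤ m, (∀ i < k, s < p i) ∧ ∀ i, k ≤ i → i < m → p i ≤ s := by
  induction m with
  | zero => exact ⟨0, le_rfl, by omega, by omega⟩
  | succ m ih =>
    by_cases h : s < p m
    · refine ⟨m + 1, le_rfl, fun i hi => ?_, by omega⟩
      exact lt_of_lt_of_le h (hp (by omega))
    · obtain ⟨k, hk, h1, h2⟩ := ih
      refine ⟨k, by omega, h1, fun i hi him => ?_⟩
      rcases Nat.lt_succ_iff_lt_or_eq.mp him with h' | h'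
      · exact h2 i hi h'
      · subst h'; omega

theorem aux_upper (m : ℕ) (a hat : ℕ → ℕ) (hh : Antitone hat)
    (h : ∀ c, ∑ i ∈ range m, (a i - c) ≤ ∑ i ∈ range m, (hat i - c))
    (I : Finset ℕ) (hI : I ⊆ range m) :
    ∑ i ∈ I, a i ≤ ∑ i ∈ range I.card, hat i := by
  rcases hc : I.card with _ | k
  · rw [Finset.card_eq_zero] at hc; subst hc; simp
  · have hkm : k + 1 ≤ m := by
      have := Finset.card_le_card hI; simp at this; omega
    have h0 := h (hat k)
    have e1 : ∑ i ∈ range m, (hat i - hat k) = ∑ i ∈ range (k+1), (hat i - hat k) := by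
      symm
      apply Finset.sum_subset
      · intro i; simp; omega
      · intro i _ hi
        have : hat i ≤ hat k := hh (by simp at hi; omega)
        omega
    have e2 : ∑ i ∈ range (k+1), hat i = ∑ i ∈ range (k+1), (hat i - hat k) + (k+1) * hat k := by
      have : ∑ i ∈ range (k+1), hat i = ∑ i ∈ range (k+1), ((hat i - hat k) + hat k) := by
        apply Finset.sum_congr rfl
        intro i hi
        have : hat k ≤ hat i := hh (by simp at hi; omega)
        omega
      rw [this, Finset.sum_add_distrib]; simp
    have e3 : ∑ i ∈ I, a i ≤ ∑ i ∈ I, (a i - hat k) + (k+1) * hat k := by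
      have : ∑ i ∈ I, a i ≤ ∑ i ∈ I, ((a i - hat k) + hat k) :=
        Finset.sum_le_sum fun i _ => by omega
      rw [Finset.sum_add_distrib] at this; simpa [hc] using this
    have e4 : ∑ i ∈ I, (a i - hat k) ≤ ∑ i ∈ range m, (a i - hat k) :=
      Finset.sum_le_sum_of_subset hI
    omega

theorem aux_lower (m : ℕ) (a bar : ℕ → ℕ) (hb : Antitone bar)
    (h : ∀ c, ∑ i ∈ range m, (c - a i) ≤ ∑ i ∈ range m, (c - bar i))
    (I : Finset ℕ) (hI : I ⊆ range m) :
    ∑ i ∈ Ico I.card m, bar i ≤ ∑ i ∈ range m \ I, a i := by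
  set j := I.card with hj
  have hjm : j ≤ m := by have := Finset.card_le_card hI; simpa using this
  have h0 := h (bar j)
  have e1 : ∑ i ∈ range m, (bar j - bar i) = ∑ i ∈ Ico j m, (bar j - bar i) := by
    symm
    apply Finset.sum_subset
    · intro i; simp
    · intro i hi hi'
      have : bar j ≤ bar i := hb (by simp at hi hi'; omega)
      omega
  have e2 : ∑ i ∈ Ico j m, bar i + ∑ i ∈ Ico j m, (bar j - bar i) = (m - j) * bar j := by
    rw [← Finset.sum_add_distrib]
    rw [Finset.sum_congr rfl (g := fun _ => bar j)]
    · simp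
    · intro i hi
      have : bar i ≤ bar j := hb (by simp at hi; omega)
      omega
  have e3 : (m - j) * bar j ≤ ∑ i ∈ range m \ I, a i + ∑ i ∈ range m \ I, (bar j - a i) := by
    rw [← Finset.sum_add_distrib]
    have hc : (range m \ I).card = m - j := by
      rw [Finset.card_sdiff_of_subset hI]; simp [hj]
    calc (m - j) * bar j = ∑ i ∈ range m \ I, bar j := by simp [hc]
      _ ≤ _ := Finset.sum_le_sum fun i _ => by omega
  have e4 : ∑ i ∈ range m \ I, (bar j - a i) ≤ ∑ i ∈ range m, (bar j - a i) :=
    Finset.sum_le_sum_of_subset Finset.sdiff_subset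
  omega

/-- Greedy construction of the dominance-maximal partition in an interval. -/
theorem aux_greedy (m : ℕ) (a bar hat : ℕ → ℕ) (hb : Antitone bar) (hh : Antitone hat)
    (hle : ∀ i, bar i ≤ hat i)
    (h1 : ∀ c, ∑ i ∈ range m, (a i - c) ≤ ∑ i ∈ range m, (hat i - c))
    (h2 : ∀ c, ∑ i ∈ range m, (c - a i) ≤ ∑ i ∈ range m, (c - bar i)) :
    ∃ l : ℕ → ℕ, Antitone l ∧ (∀ i, bar i ≤ l i) ∧ (∀ i, l i ≤ hat i) ∧
      ∑ i ∈ range m, l i = ∑ i ∈ range m, a i ∧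
      ∀ c, ∑ i ∈ range m, (a i - c) ≤ ∑ i ∈ range m, (l i - c) := by
  set n := ∑ i ∈ range m, a i with hn
  have hnb : ∑ i ∈ range m, bar i ≤ n := by
    have := aux_lower m a bar hb h2 ∅ (by simp)
    simpa using this
  have hnh : n ≤ ∑ i ∈ range m, hat i := by
    have := aux_upper m a hat hh h1 (range m) (by simp)
    simpa using this
  set N := n - ∑ i ∈ range m, bar i with hN
  let D : ℕ → ℕ := fun k => ∑ i ∈ range k, (hat i - bar i)
  have hDs : ∀ k, D (k+1) = D k + (hat k - bar k) := fun k => Finset.sum_range_succ _ _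
  have hDB : ∀ k, D k + ∑ i ∈ range k, bar i = ∑ i ∈ range k, hat i := by
    intro k
    rw [← Finset.sum_add_distrib]
    exact Finset.sum_congr rfl fun i _ => by have := hle i; omega
  let l : ℕ → ℕ := fun i => bar i + min (N - D i) (hat i - bar i)
  have hl : ∀ i, l i = bar i + min (N - D i) (hat i - bar i) := fun i => rfl
  have hpre : ∀ k, ∑ i ∈ range k, l i = ∑ i ∈ range k, bar i + min N (D k) := by
    intro k
    induction k with
    | zero => simp [D]
    | succ k ih =>
      rw [Finset.sum_range_succ, ih, Finset.sum_range_succ, hDs, hl]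
      omega
  refine ⟨l, ?_, ?_, ?_, ?_, ?_⟩
  · apply antitone_nat_of_succ_le
    intro i
    have := hl i
    have := hl (i+1)
    have := hDs i
    have := hb (Nat.le_succ i)
    have := hh (Nat.le_succ i)
    have := hle i
    have := hle (i+1)
    simp only [Nat.succ_eq_add_one] at *
    omega
  · intro i; rw [hl]; omega
  · intro i; rw [hl]; have := hle i; omega
  · rw [hpre]; have := hDB m; omega
  · intro c
    set I := (range m).filter (fun i => c < a i) with hI
    have hIs : I ⊆ range m := Finset.filter_subset _ _
    have hIc : I.card ≤ m := by have := Finset.card_le_card hIs; simpa using this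
    have u := aux_upper m a hat hh h1 I hIs
    have w := aux_lower m a bar hb h2 I hIs
    have s : ∑ i ∈ range m \ I, a i + ∑ i ∈ I, a i = n := Finset.sum_sdiff hIs
    have sb : ∑ i ∈ range I.card, bar i + ∑ i ∈ Ico I.card m, bar i = ∑ i ∈ range m, bar i :=
      Finset.sum_range_add_sum_Ico _ hIc
    have key : ∑ i ∈ I, a i ≤ ∑ i ∈ range I.card, l i := by
      rw [hpre]; have := hDB I.card; omega
    have e1 : ∑ i ∈ range m, (a i - c) = ∑ i ∈ I, (a i - c) := by
      symm
      apply Finset.sum_subset hIs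
      intro i hi hi'
      simp only [hI, Finset.mem_filter, hi, true_and] at hi'
      omega
    have e2 : ∑ i ∈ I, (a i - c) + I.card * c = ∑ i ∈ I, a i := by
      have : ∑ i ∈ I, a i = ∑ i ∈ I, ((a i - c) + c) := by
        apply Finset.sum_congr rfl
        intro i hi
        simp only [hI, Finset.mem_filter] at hi
        omega
      rw [this, Finset.sum_add_distrib]; simp
    have e3 : ∑ i ∈ range I.card, l i ≤ ∑ i ∈ range I.card, (l i - c) + I.card * c := by
      have e : ∑ i ∈ range I.card, ((l i - c) + c) =
          ∑ i ∈ range I.card, (l i - c) + I.card * c := by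
        rw [Finset.sum_add_distrib, Finset.sum_const, Finset.card_range, smul_eq_mul]
      rw [← e]
      exact Finset.sum_le_sum fun i _ => by omega
    have e4 : ∑ i ∈ range I.card, (l i - c) ≤ ∑ i ∈ range m, (l i - c) :=
      Finset.sum_le_sum_of_subset (by intro i; simp; omega)
    omega

/-- From dominance of sums of positive parts to the reflected form. -/
theorem aux_flip (m : ℕ) (a l : ℕ → ℕ) (hs : ∑ i ∈ range m, l i = ∑ i ∈ range m, a i) (c : ℕ)
    (h : ∑ i ∈ range m, (a i - c) ≤ ∑ i ∈ range m, (l i - c)) :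
    ∑ i ∈ range m, (c - a i) ≤ ∑ i ∈ range m, (c - l i) := by
  have e : ∀ f : ℕ → ℕ, ∑ i ∈ range m, f i + ∑ i ∈ range m, (c - f i) =
      ∑ i ∈ range m, (f i - c) + m * c := by
    intro f
    rw [← Finset.sum_add_distrib]
    have : m * c = ∑ i ∈ range m, c := by simp
    rw [this, ← Finset.sum_add_distrib]
    exact Finset.sum_congr rfl fun i _ => by omega
  have := e a
  have := e l
  omega

/-- Existence of a semistandard filling. -/
theorem aux_kostka (m : ℕ) : ∀ (a l : ℕ → ℕ), Antitone l → (∀ i, m ≤ i → l i = 0) →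
    ∑ i ∈ range m, l i = ∑ i ∈ range m, a i →
    (∀ c, ∑ i ∈ range m, (a i - c) ≤ ∑ i ∈ range m, (l i - c)) →
    ∃ T : ℕ → ℕ → ℕ, (∀ i j, j < l i → T i j < m) ∧
      (∀ i j₁ j₂, j₁ < j₂ → j₂ < l i → T i j₁ ≤ T i j₂) ∧
      (∀ i₁ i₂ j, i₁ < i₂ → j < l i₂ → T i₁ j < T i₂ j) ∧
      ∀ k < m, ∑ i ∈ range m, ((range (l i)).filter (fun j => T i j = k)).card = a k := by
  induction m with
  | zero =>
    intro a l hl h0 _ _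
    refine ⟨fun _ _ => 0, ?_, ?_, ?_, ?_⟩ <;> intros <;> simp_all
  | succ m ih =>
    intro a l hl h0 hs hd
    have hd' := fun c => aux_flip (m+1) a l hs c (hd c)
    have lowa : ∀ i, i < m + 1 → l m ≤ a i := by
      intro i hi
      have h := hd' (l m)
      have : ∑ i ∈ range (m+1), (l m - l i) = 0 := by
        apply Finset.sum_eq_zero
        intro i hi
        have : l m ≤ l i := hl (by simp at hi; omega)
        omega
      rw [this] at h
      have := Finset.sum_eq_zero_iff.mp (Nat.le_zero.mp h) i (by simpa using hi)
      omega
    have upa : ∀ i, i < m + 1 → a i ≤ l 0 := by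
      intro i hi
      have h := hd (l 0)
      have : ∑ i ∈ range (m+1), (l i - l 0) = 0 := by
        apply Finset.sum_eq_zero
        intro i hi
        have : l i ≤ l 0 := hl (by omega)
        omega
      rw [this] at h
      have := Finset.sum_eq_zero_iff.mp (Nat.le_zero.mp h) i (by simpa using hi)
      omega
    let hat : ℕ → ℕ := fun i => if i < m then l i else 0
    have hhat : ∀ i, i < m → hat i = l i := fun i hi => by simp [hat, hi]
    have hhat0 : ∀ i, m ≤ i → hat i = 0 := fun i hi => by simp [hat, hi]
    have hhatle : ∀ i, hat i ≤ l i := fun i => by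
      by_cases h : i < m
      · rw [hhat i h]
      · rw [hhat0 i (by omega)]; omega
    obtain ⟨κ, kanti, kb, kh, ks, kd⟩ := aux_greedy m a (fun i => l (i+1)) hat
      (fun i j hij => hl (by omega))
      (by
        intro i j hij
        by_cases hj : j < m
        · rw [hhat j hj, hhat i (by omega)]; exact hl hij
        · rw [hhat0 j (by omega)]; omega)
      (by
        intro i
        by_cases hi : i < m
        · rw [hhat i hi]; exact hl (by omega)
        · rw [h0 (i+1) (by omega)]; omega)
      (by
        intro c
        have e : ∑ i ∈ range m, (hat i - c) = ∑ i ∈ range m, (l i - c) :=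
          Finset.sum_congr rfl fun i hi => by rw [hhat i (by simpa using hi)]
        rw [e]
        have h := hd c
        rw [Finset.sum_range_succ, Finset.sum_range_succ] at h
        have := lowa m (by omega)
        omega)
      (by
        intro c
        have h := hd' c
        rw [Finset.sum_range_succ, Finset.sum_range_succ' (fun i => c - l i)] at h
        have := upa m (by omega)
        omega)
    have k0 : ∀ i, m ≤ i → κ i = 0 := fun i hi => by
      have := kh i; rw [hhat0 i hi] at this; omega
    have kl : ∀ i, κ i ≤ l i := fun i => (kh i).trans (hhatle i)
    obtain ⟨T, T1, T2, T3, T4⟩ := ih a κ kanti k0 ks kd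
    refine ⟨fun i j => if j < κ i then T i j else m, ?_, ?_, ?_, ?_⟩
    · intro i j hj
      dsimp only
      split_ifs with h
      · have := T1 i j h; omega
      · omega
    · intro i j₁ j₂ h hj
      dsimp only
      split_ifs with h1 h2 h2
      · exact T2 i _ _ h h2
      · exact (T1 i _ h1).le
      · omega
      · exact le_rfl
    · intro i₁ i₂ j h hj
      have hj1 : j < κ i₁ := by
        have h1 : l i₂ ≤ l (i₁ + 1) := hl (by omega)
        have := kb i₁
        omega
      dsimp only
      rw [if_pos hj1]
      split_ifs with h2
      · exact T3 _ _ _ h h2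
      · exact T1 _ _ hj1
    · intro k hk
      rcases Nat.lt_succ_iff_lt_or_eq.mp hk with hk' | hk'
      · rw [← T4 k hk', Finset.sum_range_succ]
        have e0 : ((range (l m)).filter (fun j => (if j < κ m then T m j else m) = k)) = ∅ := by
          apply Finset.filter_eq_empty_iff.mpr
          intro j _
          rw [k0 m le_rfl]; simp; omega
        rw [e0]
        simp only [Finset.card_empty, add_zero]
        apply Finset.sum_congr rfl
        intro i _
        congr 1
        ext j
        simp only [Finset.mem_filter, Finset.mem_range]
        have := kl i
        constructor
        · rintro ⟨h1, h2⟩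
          split_ifs at h2 with h3
          · exact ⟨h3, h2⟩
          · omega
        · rintro ⟨h1, h2⟩
          rw [if_pos h1]
          exact ⟨by omega, h2⟩
      · subst hk'
        have e : ∀ i, ((range (l i)).filter (fun j => (if j < κ i then T i j else k) = k)).card
            = l i - κ i := by
          intro i
          have : ((range (l i)).filter (fun j => (if j < κ i then T i j else k) = k))
              = Ico (κ i) (l i) := by
            ext j
            simp only [Finset.mem_filter, Finset.mem_range, Finset.mem_Ico]
            constructor
            · rintro ⟨h1, h2⟩
              split_ifs at h2 with h3
              · have := T1 i j h3; omega
              · omega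
            · rintro ⟨h1, h2⟩
              rw [if_neg (by omega)]
              exact ⟨h2, rfl⟩
          rw [this]; simp
        rw [Finset.sum_congr rfl fun i _ => e i]
        have : ∑ i ∈ range (k+1), (l i - κ i) + ∑ i ∈ range (k+1), κ i
            = ∑ i ∈ range (k+1), l i := by
          rw [← Finset.sum_add_distrib]
          exact Finset.sum_congr rfl fun i _ => by have := kl i; omega
        rw [Finset.sum_range_succ κ, k0 k le_rfl, ks, hs, Finset.sum_range_succ a] at this
        omega

theorem aux_hermite (t : ℕ) (ht : 0 < t) (P : ℕ) : ∑ j ∈ range t, (P + j) / t = P := by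
  induction P with
  | zero =>
    apply Finset.sum_eq_zero
    intro j hj
    apply Nat.div_eq_of_lt
    simpa using hj
  | succ P ih =>
    have h1 := Finset.sum_range_succ (fun j => (P + j) / t) t
    have h2 := Finset.sum_range_succ' (fun j => (P + j) / t) t
    have h3 : ∑ j ∈ range t, (P + 1 + j) / t = ∑ j ∈ range t, (P + (j + 1)) / t :=
      Finset.sum_congr rfl fun j _ => by congr 1; ring
    have h4 : (P + t) / t = P / t + 1 := Nat.add_div_right _ ht
    simp only [add_zero] at h2
    omega

/-- Integer decomposition for sorted vectors. -/
theorem aux_idp (m t : ℕ) (ht : 0 < t) (p bar hat : ℕ → ℕ) (hp : Antitone p)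
    (h1 : ∀ c, ∑ i ∈ range m, (p i - t * c) ≤ t * ∑ i ∈ range m, (hat i - c))
    (h2 : ∀ c, ∑ i ∈ range m, (t * c - p i) ≤ t * ∑ i ∈ range m, (c - bar i)) :
    ∃ v : ℕ → ℕ → ℕ, (∀ i, ∑ j ∈ range t, v j i = p i) ∧
      (∀ j < t, ∀ c, ∑ i ∈ range m, (v j i - c) ≤ ∑ i ∈ range m, (hat i - c)) ∧
      (∀ j < t, ∀ c, ∑ i ∈ range m, (c - v j i) ≤ ∑ i ∈ range m, (c - bar i)) := by
  let P : ℕ → ℕ := fun i => ∑ k ∈ range i, p k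
  have hPs : ∀ i, P (i+1) = P i + p i := fun i => Finset.sum_range_succ _ _
  let V : ℕ → ℕ → ℕ := fun j i => (P i + j) / t
  have hV : ∀ j i, V j i = (P i + j) / t := fun j i => rfl
  have hVm : ∀ j i, V j i ≤ V j (i+1) := fun j i =>
    Nat.div_le_div_right (by rw [hPs]; omega)
  let v : ℕ → ℕ → ℕ := fun j i => V j (i+1) - V j i
  have hv : ∀ j i, v j i + V j i = V j (i+1) := fun j i => by
    have := hVm j i
    simp only [v]; omega
  have hge : ∀ j i c, t * c ≤ p i → c ≤ v j i := by
    intro j i c h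
    have : V j i + c ≤ V j (i+1) := by
      rw [hV, hV, hPs, ← Nat.add_mul_div_left _ _ ht]
      exact Nat.div_le_div_right (by omega)
    have := hv j i
    omega
  have hle : ∀ j i c, p i ≤ t * c → v j i ≤ c := by
    intro j i c h
    have : V j (i+1) ≤ V j i + c := by
      rw [hV, hV, hPs, ← Nat.add_mul_div_left _ _ ht]
      exact Nat.div_le_div_right (by omega)
    have := hv j i
    omega
  have hVsum : ∀ j k, j < t → ∑ i ∈ range k, v j i = V j k := by
    intro j k hj
    induction k with
    | zero => simp [hV, P, Nat.div_eq_of_lt hj]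
    | succ k ih => rw [Finset.sum_range_succ, ih, ← hv]; omega
  refine ⟨v, ?_, ?_, ?_⟩
  · intro i
    have a1 : ∑ j ∈ range t, v j i + ∑ j ∈ range t, V j i = ∑ j ∈ range t, V j (i+1) := by
      rw [← Finset.sum_add_distrib]
      exact Finset.sum_congr rfl fun j _ => hv j i
    rw [aux_hermite t ht, aux_hermite t ht, hPs] at a1
    omega
  · intro j hj c
    obtain ⟨k, hk, k1, k2⟩ := aux_thr p hp (t*c) m
    have e1 : ∑ i ∈ range m, (v j i - c) = ∑ i ∈ range k, (v j i - c) := by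
      symm
      apply Finset.sum_subset
      · intro i; simp; omega
      · intro i hi hi'
        simp at hi hi'
        have := hle j i c (k2 i hi' hi)
        omega
    have e2 : ∑ i ∈ range k, (v j i - c) + k * c = V j k := by
      rw [← hVsum j k hj]
      have : k * c = ∑ i ∈ range k, c := by simp
      rw [this, ← Finset.sum_add_distrib]
      apply Finset.sum_congr rfl
      intro i hi
      have := hge j i c (k1 i (by simpa using hi)).le
      omega
    have e3 : P k ≤ ∑ i ∈ range m, (p i - t * c) + k * (t * c) := by
      have a1 : P k ≤ ∑ i ∈ range k, ((p i - t * c) + t * c) :=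
        Finset.sum_le_sum fun i _ => by omega
      rw [Finset.sum_add_distrib] at a1
      have a2 : ∑ i ∈ range k, (p i - t * c) ≤ ∑ i ∈ range m, (p i - t * c) :=
        Finset.sum_le_sum_of_subset (by intro i; simp; omega)
      simp only [Finset.sum_const, Finset.card_range, smul_eq_mul] at a1
      omega
    have e4 : V j k ≤ ∑ i ∈ range m, (hat i - c) + k * c := by
      rw [hV]
      apply Nat.le_of_lt_succ
      rw [Nat.div_lt_iff_lt_mul ht]
      have := h1 c
      nlinarith
    omega
  · intro j hj c
    obtain ⟨k, hk, k1, k2⟩ := aux_thr p hp (t*c) m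
    have e1 : ∑ i ∈ range m, (c - v j i) = ∑ i ∈ Ico k m, (c - v j i) := by
      symm
      apply Finset.sum_subset
      · intro i; simp
      · intro i hi hi'
        simp at hi hi'
        have := hge j i c (k1 i (by omega)).le
        omega
    have e2 : ∑ i ∈ Ico k m, (c - v j i) + V j m = V j k + (m - k) * c := by
      rw [← hVsum j m hj, ← hVsum j k hj, ← Finset.sum_range_add_sum_Ico _ hk]
      have : (m - k) * c = ∑ i ∈ Ico k m, c := by simp
      rw [this]
      have : ∑ i ∈ Ico k m, (c - v j i) + ∑ i ∈ Ico k m, v j i = ∑ i ∈ Ico k m, c := by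
        rw [← Finset.sum_add_distrib]
        apply Finset.sum_congr rfl
        intro i hi
        simp at hi
        have := hle j i c (k2 i hi.1 hi.2)
        omega
      omega
    have e3 : P k + (m - k) * (t * c) ≤ P m + ∑ i ∈ range m, (t * c - p i) := by
      have a0 : P k + ∑ i ∈ Ico k m, p i = P m := Finset.sum_range_add_sum_Ico _ hk
      have a1 : ∑ i ∈ Ico k m, t * c ≤ ∑ i ∈ Ico k m, (p i + (t * c - p i)) :=
        Finset.sum_le_sum fun i _ => by omega
      rw [Finset.sum_add_distrib] at a1
      have a2 : ∑ i ∈ Ico k m, (t * c - p i) ≤ ∑ i ∈ range m, (t * c - p i) :=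
        Finset.sum_le_sum_of_subset (by intro i; simp)
      simp only [Finset.sum_const, Nat.card_Ico, smul_eq_mul] at a1
      omega
    have e4 : V j k + (m - k) * c ≤ V j m + ∑ i ∈ range m, (c - bar i) := by
      rw [hV, hV, ← Nat.add_mul_div_left _ _ ht, ← Nat.add_mul_div_left _ _ ht]
      apply Nat.div_le_div_right
      have := h2 c
      nlinarith
    omega

/-- Extension of a finite vector by zero. -/
def extN {m : ℕ} (f : Fin m → ℕ) : ℕ → ℕ := fun i => if h : i < m then f ⟨i, h⟩ else 0

theorem extN_fin {m : ℕ} (f : Fin m → ℕ) (i : Fin m) : extN f i = f i := by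
  simp [extN]

theorem extN_lt {m : ℕ} (f : Fin m → ℕ) (i : ℕ) (h : i < m) : extN f i = f ⟨i, h⟩ := by
  simp [extN, h]

theorem extN_ge {m : ℕ} (f : Fin m → ℕ) (i : ℕ) (h : m ≤ i) : extN f i = 0 := by
  simp [extN, h]

theorem extN_anti {m : ℕ} (f : Fin m → ℕ) (h : Antitone f) : Antitone (extN f) := by
  intro i j hij
  by_cases hj : j < m
  · rw [extN_lt f j hj, extN_lt f i (by omega)]
    exact h (by simpa [Fin.le_def] using hij)
  · rw [extN_ge f j (by omega)]; omega

theorem extN_sum {m : ℕ} (f : Fin m → ℕ) (g : ℕ → ℕ) :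
    ∑ i ∈ range m, g (extN f i) = ∑ i, g (f i) := by
  rw [Finset.sum_range]
  exact Finset.sum_congr rfl fun i _ => by rw [extN_fin]

theorem mem_diagramOf {m : ℕ} (l : Fin m → ℕ) (h : Antitone l) (i j : ℕ) :
    (i, j) ∈ (diagramOf l h) ↔ j < extN l i := by
  rw [← YoungDiagram.mem_cells]
  simp only [diagramOf, Finset.mem_biUnion, Finset.mem_univ, true_and, Finset.mem_image,
    Finset.mem_range, Prod.mk.injEq]
  constructor
  · rintro ⟨a, b, hb, rfl, rfl⟩
    rwa [extN_fin]
  · intro hj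
    by_cases hi : i < m
    · rw [extN_lt l i hi] at hj
      exact ⟨⟨i, hi⟩, j, hj, rfl, rfl⟩
    · rw [extN_ge l i (by omega)] at hj; omega

theorem card_cells {m : ℕ} (l : Fin m → ℕ) (h : Antitone l) (q : ℕ × ℕ → Prop)
    [DecidablePred q] :
    ((diagramOf l h).cells.filter q).card =
      ∑ i ∈ range m, ((range (extN l i)).filter (fun j => q (i, j))).card := by
  rw [Finset.card_eq_sum_card_fiberwise (f := Prod.fst) (t := range m)]
  · apply Finset.sum_congr rfl
    intro i _
    have : (((diagramOf l h).cells.filter q).filter (fun x => x.1 = i)) =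
        ((range (extN l i)).filter (fun j => q (i, j))).image (fun j => (i, j)) := by
      ext ⟨a, b⟩
      simp only [Finset.mem_filter, YoungDiagram.mem_cells, mem_diagramOf, Finset.mem_image,
        Finset.mem_range, Prod.mk.injEq]
      constructor
      · rintro ⟨⟨h1, h2⟩, rfl⟩
        exact ⟨b, ⟨h1, h2⟩, rfl, rfl⟩
      · rintro ⟨b', ⟨h1, h2⟩, rfl, rfl⟩
        exact ⟨⟨h1, h2⟩, rfl⟩
    rw [this, Finset.card_image_of_injective]
    intro a b hab
    simpa using hab
  · rintro ⟨a, b⟩ hx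
    simp only [Finset.coe_filter, YoungDiagram.mem_cells, mem_diagramOf, Set.mem_ofPred_eq] at hx
    simp only [Finset.coe_range, Set.mem_Iio]
    by_contra hc
    rw [extN_ge l a (by omega)] at hx
    omega

theorem schur_dom {m : ℕ} (l : Fin m → ℕ) (h : Antitone l) (a : Fin m → ℕ)
    (hs : schurCoeff m (diagramOf l h) a ≠ 0) :
    ∑ i, l i = ∑ i, a i ∧ ∀ c, ∑ i, (a i - c) ≤ ∑ i, (l i - c) := by
  have hne : Nonempty {T : SemistandardYoungTableau (diagramOf l h) //
      (∀ i j : ℕ, (i, j) ∈ diagramOf l h → T i j < m) ∧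
      ∀ k : Fin m, content (diagramOf l h) T (k : ℕ) = a k} := by
    by_contra hc
    rw [not_nonempty_iff] at hc
    exact hs (by unfold schurCoeff; exact Nat.card_of_isEmpty)
  obtain ⟨T, hT, hTc⟩ := hne
  have tot : ∀ q : ℕ × ℕ → Prop, [DecidablePred q] →
      ∑ k : Fin m, (((diagramOf l h).cells.filter q).filter
        (fun x => T x.1 x.2 = (k : ℕ))).card = ((diagramOf l h).cells.filter q).card := by
    intro q _
    rw [Finset.card_eq_sum_card_fiberwise (f := fun x : ℕ × ℕ => T x.1 x.2) (t := range m),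
      Finset.sum_range]
    rintro ⟨x, y⟩ hx
    simp only [Finset.coe_filter, YoungDiagram.mem_cells, Set.mem_ofPred_eq] at hx
    simp only [Finset.coe_range, Set.mem_Iio]
    exact hT x y hx.1
  have key : ∀ c, ∑ i, (a i - c) ≤ ∑ i, (l i - c) := by
    intro c
    have h1 := tot (fun x => c ≤ x.2)
    rw [card_cells] at h1
    have h2 : ∀ i, ((range (extN l i)).filter (fun j => c ≤ j)).card = extN l i - c := by
      intro i
      have : (range (extN l i)).filter (fun j => c ≤ j) = Ico c (extN l i) := by
        ext j; simp; omega
      rw [this]; simp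
    simp only [h2] at h1
    rw [extN_sum l (fun x => x - c)] at h1
    rw [← h1]
    apply Finset.sum_le_sum
    intro k _
    rw [← hTc k]
    unfold content
    set A := (diagramOf l h).cells.filter (fun x => T x.1 x.2 = (k : ℕ)) with hA
    have e := Finset.card_filter_add_card_filter_not (s := A) (fun x : ℕ × ℕ => c ≤ x.2)
    have e1 : A.filter (fun x : ℕ × ℕ => c ≤ x.2) =
        ((diagramOf l h).cells.filter (fun x => c ≤ x.2)).filter
          (fun x => T x.1 x.2 = (k : ℕ)) := by
      rw [hA]; exact Finset.filter_comm _ _ _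
    have e2 : (A.filter (fun x : ℕ × ℕ => ¬ c ≤ x.2)).card ≤ c := by
      have : (A.filter (fun x : ℕ × ℕ => ¬ c ≤ x.2)).card ≤ (range c).card := by
        apply Finset.card_le_card_of_injOn Prod.snd
        · rintro ⟨x, y⟩ hx
          simp at hx
          simpa using hx.2
        · rintro ⟨x, y⟩ hx ⟨x', y'⟩ hx' hxy
          simp only [hA, Finset.coe_filter, Finset.mem_filter, YoungDiagram.mem_cells,
            Set.mem_ofPred_eq] at hx hx' hxy
          subst hxy
          rcases lt_trichotomy x x' with h' | h' | h'
          · have := T.col_strict h' hx'.1.1; omega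
          · rw [h']
          · have := T.col_strict h' hx.1.1; omega
      simpa using this
    rw [← e1]
    omega
  refine ⟨?_, key⟩
  have h1 := tot (fun _ => True)
  rw [card_cells] at h1
  simp only [Finset.filter_true, Finset.card_range] at h1
  rw [extN_sum l (fun x => x)] at h1
  rw [← h1]
  exact Finset.sum_congr rfl fun k _ => hTc k

theorem schur_finite {m : ℕ} (μ : YoungDiagram) (a : Fin m → ℕ) :
    Finite {T : SemistandardYoungTableau μ // (∀ i j : ℕ, (i, j) ∈ μ → T i j < m) ∧
    ∀ k : Fin m, content μ T (k : ℕ) = a k} := by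
  apply Finite.of_injective (β := μ.cells → Fin m)
    (fun T x => ⟨T.1 x.1.1 x.1.2, T.2.1 _ _ ((YoungDiagram.mem_cells _).mp x.2)⟩)
  intro T T' hTT
  apply Subtype.ext
  ext i j
  by_cases hij : (i, j) ∈ μ
  · have := congrFun hTT ⟨(i, j), (YoungDiagram.mem_cells _).mpr hij⟩
    simpa using this
  · rw [T.1.zeros hij, T'.1.zeros hij]

theorem schur_pos {m : ℕ} (l : Fin m → ℕ) (h : Antitone l) (a : Fin m → ℕ)
    (hs : ∑ i, l i = ∑ i, a i) (hd : ∀ c, ∑ i, (a i - c) ≤ ∑ i, (l i - c)) :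
    schurCoeff m (diagramOf l h) a ≠ 0 := by
  obtain ⟨T, T1, T2, T3, T4⟩ := aux_kostka m (extN a) (extN l) (extN_anti l h) (extN_ge l)
    (by rw [extN_sum l (fun x => x), extN_sum a (fun x => x)]; exact hs)
    (by intro c; rw [extN_sum l (fun x => x - c), extN_sum a (fun x => x - c)]; exact hd c)
  have := schur_finite (m := m) (diagramOf l h) a
  let S : SemistandardYoungTableau (diagramOf l h) :=
    { entry := fun i j => if j < extN l i then T i j else 0
      row_weak' := by
        intro i j1 j2 hj hm
        rw [mem_diagramOf] at hm
        rw [if_pos hm, if_pos (by omega)]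
        exact T2 _ _ _ hj hm
      col_strict' := by
        intro i1 i2 j hi hm
        rw [mem_diagramOf] at hm
        have := extN_anti l h hi.le
        rw [if_pos hm, if_pos (by omega)]
        exact T3 _ _ _ hi hm
      zeros' := by
        intro i j hm
        rw [mem_diagramOf] at hm
        rw [if_neg hm] }
  have hS : ∀ i j, j < extN l i → S i j = T i j := by
    intro i j hij
    show (if j < extN l i then T i j else 0) = _
    rw [if_pos hij]
  have : Nonempty {T : SemistandardYoungTableau (diagramOf l h) //
      (∀ i j : ℕ, (i, j) ∈ diagramOf l h → T i j < m) ∧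
      ∀ k : Fin m, content (diagramOf l h) T (k : ℕ) = a k} := by
    refine ⟨S, ?_, ?_⟩
    · intro i j hij
      rw [mem_diagramOf] at hij
      rw [hS i j hij]
      exact T1 i j hij
    · intro k
      unfold content
      rw [card_cells]
      rw [← extN_fin a k, ← T4 k k.2]
      apply Finset.sum_congr rfl
      intro i _
      congr 1
      apply Finset.filter_congr
      intro j hj
      rw [hS i j (by simpa using hj)]
  exact Nat.card_pos.ne'

/-- The natural points of the symmetric generalized polymatroid. -/
def InQ {m : ℕ} (bar hat a : Fin m → ℕ) : Prop :=
  (∀ c, ∑ i, (a i - c) ≤ ∑ i, (hat i - c)) ∧ ∀ c, ∑ i, (c - a i) ≤ ∑ i, (c - bar i)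

theorem fin_flip {m : ℕ} (a l : Fin m → ℕ) (hs : ∑ i, l i = ∑ i, a i) (c : ℕ)
    (h : ∑ i, (a i - c) ≤ ∑ i, (l i - c)) : ∑ i, (c - a i) ≤ ∑ i, (c - l i) := by
  rw [← extN_sum a (fun x => c - x), ← extN_sum l (fun x => c - x)]
  apply aux_flip
  · rw [extN_sum l (fun x => x), extN_sum a (fun x => x)]; exact hs
  · rw [extN_sum l (fun x => x - c), extN_sum a (fun x => x - c)]; exact h

theorem inQ_of_schur {m : ℕ} (bar hat l : Fin m → ℕ) (h : Antitone l) (h1 : bar ≤ l)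
    (h2 : l ≤ hat) (a : Fin m → ℕ) (hs : schurCoeff m (diagramOf l h) a ≠ 0) :
    InQ bar hat a := by
  obtain ⟨e, d⟩ := schur_dom l h a hs
  refine ⟨fun c => (d c).trans ?_, fun c => (fin_flip a l e c (d c)).trans ?_⟩
  · exact Finset.sum_le_sum fun i _ => by have : l i ≤ hat i := h2 i; omega
  · exact Finset.sum_le_sum fun i _ => by have : bar i ≤ l i := h1 i; omega

theorem schur_of_inQ {m : ℕ} (bar hat : Fin m → ℕ) (hb : Antitone bar) (hh : Antitone hat)
    (hle : bar ≤ hat) (a : Fin m → ℕ) (hs : InQ bar hat a) :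
    ∃ l : Fin m → ℕ, ∃ h : Antitone l, bar ≤ l ∧ l ≤ hat ∧
      schurCoeff m (diagramOf l h) a ≠ 0 := by
  obtain ⟨l, l1, l2, l3, l4, l5⟩ := aux_greedy m (extN a) (extN bar) (extN hat)
    (extN_anti _ hb) (extN_anti _ hh)
    (by
      intro i
      by_cases hi : i < m
      · rw [extN_lt _ i hi, extN_lt _ i hi]; exact hle _
      · rw [extN_ge _ i (by omega), extN_ge _ i (by omega)])
    (by intro c; rw [extN_sum a (fun x => x - c), extN_sum hat (fun x => x - c)]; exact hs.1 c)
    (by intro c; rw [extN_sum a (fun x => c - x), extN_sum bar (fun x => c - x)]; exact hs.2 c)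
  have hl : Antitone (fun i : Fin m => l i) := fun i j hij => l1 hij
  refine ⟨fun i => l i, hl, fun i => ?_, fun i => ?_, ?_⟩
  · have := l2 i; rwa [extN_fin] at this
  · have := l3 i; rwa [extN_fin] at this
  · apply schur_pos
    · rw [extN_sum a (fun x => x), Finset.sum_range] at l4
      exact l4
    · intro c
      have := l5 c
      rw [extN_sum a (fun x => x - c), Finset.sum_range] at this
      exact this

theorem inQ_perm {m : ℕ} (bar hat a : Fin m → ℕ) (σ : Equiv.Perm (Fin m))
    (h : InQ bar hat a) : InQ bar hat (a ∘ σ) := by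
  refine ⟨fun c => ?_, fun c => ?_⟩
  · rw [show ∑ i, ((a ∘ σ) i - c) = ∑ i, (a i - c) from Equiv.sum_comp σ (fun i => a i - c)]
    exact h.1 c
  · rw [show ∑ i, (c - (a ∘ σ) i) = ∑ i, (c - a i) from Equiv.sum_comp σ (fun i => c - a i)]
    exact h.2 c

theorem fin_idp {m : ℕ} (bar hat p : Fin m → ℕ) (t : ℕ) (ht : 0 < t)
    (h1 : ∀ c, ∑ i, (p i - t * c) ≤ t * ∑ i, (hat i - c))
    (h2 : ∀ c, ∑ i, (t * c - p i) ≤ t * ∑ i, (c - bar i)) :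
    ∃ v : Fin t → Fin m → ℕ, (∀ j, InQ bar hat (v j)) ∧ ∀ i, ∑ j, v j i = p i := by
  obtain ⟨σ, hσ⟩ : ∃ σ : Equiv.Perm (Fin m), Antitone (p ∘ σ) :=
    ⟨Tuple.sort (OrderDual.toDual ∘ p), fun i j hij =>
      Tuple.monotone_sort (OrderDual.toDual ∘ p) hij⟩
  obtain ⟨v, v1, v2, v3⟩ := aux_idp m t ht (extN (p ∘ σ)) (extN bar) (extN hat)
    (extN_anti _ hσ)
    (by
      intro c
      rw [extN_sum _ (fun x => x - t * c), extN_sum hat (fun x => x - c)]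
      rw [show ∑ i, ((p ∘ σ) i - t * c) = ∑ i, (p i - t * c) from
        Equiv.sum_comp σ (fun i => p i - t * c)]
      exact h1 c)
    (by
      intro c
      rw [extN_sum _ (fun x => t * c - x), extN_sum bar (fun x => c - x)]
      rw [show ∑ i, (t * c - (p ∘ σ) i) = ∑ i, (t * c - p i) from
        Equiv.sum_comp σ (fun i => t * c - p i)]
      exact h2 c)
  refine ⟨fun j => (fun i : Fin m => v j i) ∘ σ.symm, fun j => ?_, fun i => ?_⟩
  · apply inQ_perm
    refine ⟨fun c => ?_, fun c => ?_⟩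
    · have := v2 j j.2 c
      rw [extN_sum hat (fun x => x - c), Finset.sum_range] at this
      exact this
    · have := v3 j j.2 c
      rw [extN_sum bar (fun x => c - x), Finset.sum_range] at this
      exact this
  · have := v1 (σ.symm i)
    rw [extN_fin, Finset.sum_range] at this
    simpa using this

/-- The real polytope. -/
def QR {m : ℕ} (bar hat : Fin m → ℕ) : Set (Fin m → ℝ) :=
  {x | (∀ c : ℕ, ∑ i, max (x i - c) 0 ≤ ((∑ i, (hat i - c) : ℕ) : ℝ)) ∧
    ∀ c : ℕ, ∑ i, max (c - x i) 0 ≤ ((∑ i, (c - bar i) : ℕ) : ℝ)}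

theorem cast_tsub_max (a b : ℕ) : ((a - b : ℕ) : ℝ) = max ((a : ℝ) - b) 0 := by
  rcases le_total b a with h | h
  · rw [Nat.cast_sub h, max_eq_left]
    have : (b : ℝ) ≤ a := by exact_mod_cast h
    linarith
  · rw [Nat.sub_eq_zero_of_le h, max_eq_right]
    · simp
    · have : (a : ℝ) ≤ b := by exact_mod_cast h
      linarith

theorem max_conv (u v a b : ℝ) (ha : 0 ≤ a) (hb : 0 ≤ b) :
    max (a * u + b * v) 0 ≤ a * max u 0 + b * max v 0 := by
  apply max_le
  · have := mul_le_mul_of_nonneg_left (le_max_left u 0) ha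
    have := mul_le_mul_of_nonneg_left (le_max_left v 0) hb
    linarith
  · positivity

theorem QR_convex {m : ℕ} (bar hat : Fin m → ℕ) : Convex ℝ (QR bar hat) := by
  intro x hx y hy a b ha hb hab
  have gen : ∀ (f g : Fin m → ℝ) (K : ℝ), ∑ i, max (f i) 0 ≤ K → ∑ i, max (g i) 0 ≤ K →
      ∑ i, max (a * f i + b * g i) 0 ≤ K := by
    intro f g K hf hg
    calc ∑ i, max (a * f i + b * g i) 0 ≤ ∑ i, (a * max (f i) 0 + b * max (g i) 0) :=
          Finset.sum_le_sum fun i _ => max_conv _ _ _ _ ha hb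
      _ = a * ∑ i, max (f i) 0 + b * ∑ i, max (g i) 0 := by
          rw [Finset.sum_add_distrib, Finset.mul_sum, Finset.mul_sum]
      _ ≤ a * K + b * K := by gcongr
      _ = K := by rw [← add_mul, hab, one_mul]
  refine ⟨fun c => ?_, fun c => ?_⟩
  · have := gen (fun i => x i - c) (fun i => y i - c) _ (hx.1 c) (hy.1 c)
    convert this using 4 with i
    simp only [Pi.add_apply, Pi.smul_apply, smul_eq_mul]
    linear_combination (c : ℝ) * hab
  · have := gen (fun i => c - x i) (fun i => c - y i) _ (hx.2 c) (hy.2 c)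
    convert this using 4 with i
    simp only [Pi.add_apply, Pi.smul_apply, smul_eq_mul]
    linear_combination -(c : ℝ) * hab

theorem QR_of_inQ {m : ℕ} (bar hat a : Fin m → ℕ) (h : InQ bar hat a) :
    (fun i => (a i : ℝ)) ∈ QR bar hat := by
  refine ⟨fun c => ?_, fun c => ?_⟩
  · simp only [← cast_tsub_max]
    exact_mod_cast h.1 c
  · simp only [← cast_tsub_max]
    exact_mod_cast h.2 c

/-- Lattice points of the dilate `t • QR`. -/
theorem QR_lattice {m : ℕ} (bar hat : Fin m → ℕ) (t : ℕ) (ht : 0 < t) (y : Fin m → ℝ)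
    (hy : y ∈ QR bar hat) (hl : IsLattice ((t : ℝ) • y)) :
    ∃ p : Fin m → ℕ, (t : ℝ) • y = (fun i => (p i : ℝ)) ∧
      (∀ c, ∑ i, (p i - t * c) ≤ t * ∑ i, (hat i - c)) ∧
      (∀ c, ∑ i, (t * c - p i) ≤ t * ∑ i, (c - bar i)) := by
  have htr : (0 : ℝ) < t := by exact_mod_cast ht
  have hpos : ∀ i, 0 ≤ y i := by
    intro i
    have h := hy.2 0
    simp only [Nat.zero_sub, Finset.sum_const_zero, Nat.cast_zero] at h
    have h' : max (0 - y i) 0 ≤ ∑ i, max (0 - y i) 0 :=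
      Finset.single_le_sum (f := fun i => max (0 - y i) 0) (fun j _ => le_max_right _ _)
        (Finset.mem_univ i)
    have := le_max_left (0 - y i) 0
    linarith
  have hex : ∀ i, ∃ n : ℕ, t * y i = n := by
    intro i
    obtain ⟨z, hz⟩ := hl i
    simp only [Pi.smul_apply, smul_eq_mul] at hz
    have hz0 : 0 ≤ z := by
      have : (0 : ℝ) ≤ z := by rw [← hz]; exact mul_nonneg htr.le (hpos i)
      exact_mod_cast this
    lift z to ℕ using hz0
    exact ⟨z, by rw [hz]; simp⟩
  choose p hp using hex
  refine ⟨p, ?_, fun c => ?_, fun c => ?_⟩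
  · ext i; simp [hp]
  · have h := mul_le_mul_of_nonneg_left (hy.1 c) htr.le
    rw [Finset.mul_sum] at h
    have e : ∀ i, (t : ℝ) * max (y i - c) 0 = ((p i - t * c : ℕ) : ℝ) := by
      intro i
      rw [cast_tsub_max, mul_max_of_nonneg _ _ htr.le, mul_sub, hp]; simp
    simp only [e] at h
    exact_mod_cast h
  · have h := mul_le_mul_of_nonneg_left (hy.2 c) htr.le
    rw [Finset.mul_sum] at h
    have e : ∀ i, (t : ℝ) * max (c - y i) 0 = ((t * c - p i : ℕ) : ℝ) := by
      intro i
      rw [cast_tsub_max, mul_max_of_nonneg _ _ htr.le, mul_sub, hp]; simp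
    simp only [e] at h
    exact_mod_cast h

/-- If in a linear combination `F = ∑ j, C j • s_{μ j}` of Schur polynomials any two Schur
polynomials of the same degree have coefficients of the same sign, and the partitions appearing
are exactly those in a componentwise interval `[λ̄, λ̂]`, then `F` has saturated Newton polytope
and `Newton(F)` has the integer decomposition property. -/
theorem interval_same_sign_hasSNP_and_IDP (m : ℕ) (ι : Type) [Fintype ι]
    (C : ι → ℝ) (hC : ∀ j, C j ≠ 0)
    (μ : ι → Fin m → ℕ) (hμ : ∀ j, Antitone (μ j))
    (F : (Fin m → ℕ) → ℝ)
    (hF : F = fun α => ∑ j, C j * (schurCoeff m (diagramOf (μ j) (hμ j)) α : ℝ))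
    -- (a') same sign within each degree
    (hsign : ∀ j j' : ι, (∑ k, μ j k) = (∑ k, μ j' k) → 0 ≤ C j * C j')
    -- (b') the partitions appearing are exactly those in the interval [lambar, lamhat]
    (lambar lamhat : Fin m → ℕ) (hbar : Antitone lambar) (hhat : Antitone lamhat)
    (hle : lambar ≤ lamhat)
    (hint : ∀ ν : Fin m → ℕ, Antitone ν → ((∃ j, μ j = ν) ↔ (lambar ≤ ν ∧ ν ≤ lamhat))) :
    HasSNP F ∧ HasIDP (NewtonP F) := by
  have hFQ : ∀ a : Fin m → ℕ, F a ≠ 0 ↔ InQ lambar lamhat a := by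
    intro a
    constructor
    · intro h
      rw [hF] at h
      obtain ⟨j, _, hj⟩ := Finset.exists_ne_zero_of_sum_ne_zero h
      have hs : schurCoeff m (diagramOf (μ j) (hμ j)) a ≠ 0 := by
        intro h0; rw [h0] at hj; simp at hj
      have hb := (hint (μ j) (hμ j)).mp ⟨j, rfl⟩
      exact inQ_of_schur lambar lamhat (μ j) (hμ j) hb.1 hb.2 a hs
    · intro h
      obtain ⟨l, hl, l1, l2, l3⟩ := schur_of_inQ lambar lamhat hbar hhat hle a h
      obtain ⟨j, rfl⟩ := (hint l hl).mpr ⟨l1, l2⟩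
      have hpos : 0 < C j * F a := by
        rw [hF]
        simp only [Finset.mul_sum]
        apply Finset.sum_pos'
        · intro k _
          by_cases hk : schurCoeff m (diagramOf (μ k) (hμ k)) a = 0
          · rw [hk]; simp
          · rw [← mul_assoc]
            apply mul_nonneg _ (Nat.cast_nonneg _)
            apply hsign
            rw [(schur_dom _ _ _ l3).1, (schur_dom _ _ _ hk).1]
        · refine ⟨j, Finset.mem_univ _, ?_⟩
          rw [← mul_assoc]
          apply mul_pos
          · exact mul_self_pos.mpr (hC j)
          · exact_mod_cast Nat.pos_of_ne_zero l3
      intro h0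
      rw [h0, mul_zero] at hpos
      exact lt_irrefl _ hpos
  have hNQ : NewtonP F ⊆ QR lambar lamhat := by
    apply convexHull_min _ (QR_convex _ _)
    rintro x ⟨a, ha, rfl⟩
    exact QR_of_inQ _ _ _ ((hFQ a).mp ha)
  have hQN : ∀ a : Fin m → ℕ, InQ lambar lamhat a → (fun i => (a i : ℝ)) ∈ Supp F :=
    fun a ha => ⟨a, (hFQ a).mpr ha, rfl⟩
  constructor
  · apply Set.Subset.antisymm
    · rintro x ⟨hx, hxl⟩
      obtain ⟨p, hp, p1, p2⟩ := QR_lattice lambar lamhat 1 one_pos x (hNQ hx)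
        (by simpa using hxl)
      have hp' : x = fun i => (p i : ℝ) := by simpa using hp
      rw [hp']
      apply hQN
      exact ⟨fun c => by simpa using p1 c, fun c => by simpa using p2 c⟩
    · rintro x hx
      refine ⟨subset_convexHull ℝ _ hx, ?_⟩
      obtain ⟨a, _, rfl⟩ := hx
      exact fun i => ⟨a i, by simp⟩
  · rintro t ht p ⟨y, hy, rfl⟩ hl
    obtain ⟨p, hp, p1, p2⟩ := QR_lattice lambar lamhat t ht y (hNQ hy) hl
    obtain ⟨v, v1, v2⟩ := fin_idp lambar lamhat p t ht p1 p2
    refine ⟨fun j i => (v j i : ℝ), fun j => ⟨subset_convexHull ℝ _ (hQN _ (v1 j)), ?_⟩, ?_⟩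
    · exact fun i => ⟨v j i, by simp⟩
    · show (t : ℝ) • y = _
      rw [hp]
      ext i
      rw [Finset.sum_apply, ← v2 i]
      push_cast
      rfl
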